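/- Let G be a finite connected simple graph with at least two cycles (equivalently, |E(G)| ≥ |V(G)| + 1), let T be a tree, and let π : T → G be a covering map. Then there exists ε > 0 such that every finitely supported x : V(T) → ℝ with ∑_v x_v² ≤ 1 satisfies f_T(x) = 2∑_{{u,v}∈E(T)} x_u x_v ≤ λ₁(G) − ε. -/

import Mathlib

open SimpleGraph

/-- A covering map of simple graphs: a graph homomorphism that is a local bijection on
neighbourhoods. -/
def IsGraphCover {α β : Type*} {T : SimpleGraph α} {G : SimpleGraph β} (π : T →g G) : Prop :=
  ∀ v : α, Set.BijOn π (T.neighborSet v) (G.neighborSet (π v))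

/-- The cycles of a graph, identified with their edge sets. -/
def cycleSets {α : Type*} (G : SimpleGraph α) : Set (Set (Sym2 α)) :=
  {s | ∃ (v : α) (w : G.Walk v v), w.IsCycle ∧ s = {e | e ∈ w.edges}}

open scoped Classical in
/-- `f_H(x) = 2 ∑_{{u,v} ∈ E(H)} x_u x_v` for a finitely supported `x`, written as a sum
over ordered pairs of adjacent vertices (each edge contributes twice). -/
noncomputable def quadForm {α : Type*} (H : SimpleGraph α) (x : α →₀ ℝ) : ℝ :=
  ∑ u ∈ x.support, ∑ v ∈ x.support, if H.Adj u v then x u * x v else 0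

lemma adjMatrix_isHermitian {β : Type*} [Fintype β] [DecidableEq β]
    (G : SimpleGraph β) [DecidableRel G.Adj] : (G.adjMatrix ℝ).IsHermitian := by
  rw [Matrix.IsHermitian, Matrix.conjTranspose_eq_transpose_of_trivial]
  exact G.isSymm_adjMatrix

/-- `λ₁(G)`: the largest eigenvalue of the adjacency matrix of the finite graph `G`. -/
noncomputable def lambdaOne {β : Type*} [Fintype β] [DecidableEq β] [Nonempty β]
    (G : SimpleGraph β) [DecidableRel G.Adj] : ℝ :=
  ⨆ i, (adjMatrix_isHermitian G).eigenvalues i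

namespace SimpleGraph

/-- A connected finite graph with two distinct cycles has more edges than vertices. -/
lemma Connected.card_lt_card_edgeFinset_of_two_cycles {β : Type*} [Fintype β] [DecidableEq β]
    {G : SimpleGraph β} [DecidableRel G.Adj] (hG : G.Connected)
    (hcyc : ∃ s ∈ cycleSets G, ∃ t ∈ cycleSets G, s ≠ t) :
    Fintype.card β < G.edgeFinset.card := by
  obtain ⟨e, s, hs, t, ht, hes, het⟩ :
      ∃ e, ∃ s ∈ cycleSets G, ∃ t ∈ cycleSets G, e ∈ s ∧ e ∉ t := by
    obtain ⟨s, hs, t, ht, hst⟩ := hcyc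
    by_cases h : s ⊆ t
    · obtain ⟨e, he, he'⟩ := Set.exists_of_ssubset (h.ssubset_of_ne hst)
      exact ⟨e, t, ht, s, hs, he, he'⟩
    · obtain ⟨e, he, he'⟩ := Set.not_subset.mp h
      exact ⟨e, s, hs, t, ht, he, he'⟩
  obtain ⟨v, p, hp, rfl⟩ := hs
  obtain ⟨w, q, hq, rfl⟩ := ht
  have heG : e ∈ G.edgeSet := p.edges_subset_edgeSet hes
  have hnb : ¬ G.IsBridge e := fun hb ↦ hb.notMem_edges_of_isCycle hp hes
  have hconn : (G.deleteEdges {e}).Connected := by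
    induction e with | h x y => exact hG.connected_delete_edge_of_not_isBridge hnb
  have hntree : ¬ (G.deleteEdges {e}).IsTree := fun h ↦
    h.isAcyclic _ <| hq.toDeleteEdges _ {e} fun e' he' ↦ by
      rintro rfl
      exact het he'
  have hle := hconn.card_vert_le_card_edgeSet_add_one
  have hne := mt isTree_iff_connected_and_card.mpr hntree
  simp only [hconn, true_and] at hne
  have hlt : Nat.card (G.deleteEdges {e}).edgeSet < Nat.card G.edgeSet := by
    refine Set.ncard_lt_ncard ?_ (Set.toFinite _)
    rw [edgeSet_deleteEdges]
    exact ⟨Set.sdiff_subset, fun h ↦ (h heG).2 rfl⟩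
  rw [← Nat.card_eq_fintype_card, ← Set.ncard_coe_finset, coe_edgeFinset]
  change _ < Nat.card G.edgeSet
  omega

/-- The parent of a vertex in a rooted tree is unique. -/
lemma IsTree.eq_of_adj_of_dist_lt {α : Type*} {T : SimpleGraph α} (hT : T.IsTree) (r : α)
    {u v w : α} (hv : T.Adj u v) (hw : T.Adj u w) (hvu : T.dist r v < T.dist r u)
    (hwu : T.dist r w < T.dist r u) : v = w := by
  obtain ⟨p, hp, -⟩ := (hT.connected r u).exists_path_of_dist
  have key : ∀ x, T.Adj u x → T.dist r x < T.dist r u → x = p.penultimate := by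
    intro x hx hxu
    obtain ⟨q, hq, hql⟩ := (hT.connected r x).exists_path_of_dist
    refine hT.isAcyclic.eq_penultimate_of_adj_end hp hx ?_
    refine hT.isAcyclic.mem_support_of_ne_mem_support_of_adj_of_isPath hp hq hx fun hu ↦ ?_
    classical
    have h₁ := dist_le (q.takeUntil u hu)
    have h₂ := q.length_takeUntil_le_length hu
    omega
  rw [key v hv hvu, key w hw hwu]

/-- On a finite connected graph every function with zero sum is the divergence of a flow. -/
lemma Connected.exists_flow_of_sum_eq_zero {β : Type*} [Fintype β] [DecidableEq β]
    {G : SimpleGraph β} [DecidableRel G.Adj] (hG : G.Connected) (D : β → ℝ)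
    (hD : ∑ b, D b = 0) :
    ∃ φ : β → β → ℝ, (∀ a b, φ a b + φ b a = 0) ∧
      ∀ b, ∑ c ∈ G.neighborFinset b, φ b c = D b := by
  obtain ⟨r⟩ := hG.nonempty
  have key : ∀ a, ∃ φ : β → β → ℝ, (∀ a b, φ a b + φ b a = 0) ∧
      ∀ b, ∑ c ∈ G.neighborFinset b, φ b c =
        (if b = a then 1 else 0) - (if b = r then 1 else 0) := by
    intro a
    have hr : Relation.ReflTransGen G.Adj r a :=
      (reachable_iff_reflTransGen r a).mp (hG r a)
    induction hr with
    | refl => exact ⟨0, by simp, by simp⟩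
    | @tail a a' _ hadj ih =>
      obtain ⟨φ, hφ, hdiv⟩ := ih
      refine ⟨fun b c ↦ φ b c + ((if b = a' then if c = a then 1 else 0 else 0) -
        (if b = a then if c = a' then 1 else 0 else 0)), fun b c ↦ ?_, fun b ↦ ?_⟩
      · have := hφ b c
        dsimp only
        split_ifs <;> linarith
      · rw [Finset.sum_add_distrib, hdiv, Finset.sum_sub_distrib]
        have h₁ : (∑ c ∈ G.neighborFinset b,
            if b = a' then if c = a then (1 : ℝ) else 0 else 0) = if b = a' then 1 else 0 := by
          split_ifs with h
          · subst h
            simp [hadj.symm]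
          · simp
        have h₂ : (∑ c ∈ G.neighborFinset b,
            if b = a then if c = a' then (1 : ℝ) else 0 else 0) = if b = a then 1 else 0 := by
          split_ifs with h
          · subst h
            simp [hadj]
          · simp
        rw [h₁, h₂]
        ring
  choose φ hφ hdiv using key
  refine ⟨fun b c ↦ ∑ a, D a * φ a b c, fun b c ↦ ?_, fun b ↦ ?_⟩
  · rw [← Finset.sum_add_distrib]
    exact Finset.sum_eq_zero fun a _ ↦ by rw [← mul_add, hφ, mul_zero]
  · rw [Finset.sum_comm]
    simp_rw [← Finset.mul_sum, hdiv, mul_sub, Finset.sum_sub_distrib, ← Finset.sum_mul, hD]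
    simp

/-- If a finite connected graph has more edges than vertices, there is a constant `k ≥ 0` and an
edge weighting, of total weight `k` over the two directions of each edge, whose total outgoing
weight at every vertex is `k + 1`. -/
lemma Connected.exists_flow_of_card_lt {β : Type*} [Fintype β] [DecidableEq β]
    {G : SimpleGraph β} [DecidableRel G.Adj] (hG : G.Connected)
    (hcard : Fintype.card β < G.edgeFinset.card) :
    ∃ (k : ℝ) (F : β → β → ℝ), 0 ≤ k ∧ (∀ a b, F a b + F b a = k) ∧
      ∀ b, ∑ c ∈ G.neighborFinset b, F b c = k + 1 := by
  set k : ℝ := Fintype.card β / (G.edgeFinset.card - Fintype.card β) with hk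
  have hpos : (0 : ℝ) < G.edgeFinset.card - Fintype.card β := by
    rw [sub_pos]
    exact_mod_cast hcard
  obtain ⟨φ, hφ, hdiv⟩ := hG.exists_flow_of_sum_eq_zero (fun b ↦ k + 1 - G.degree b * (k / 2)) (by
    rw [Finset.sum_sub_distrib, ← Finset.sum_mul, ← Nat.cast_sum,
      G.sum_degrees_eq_twice_card_edges]
    simp only [Finset.sum_const, Finset.card_univ, nsmul_eq_mul, Nat.cast_mul, Nat.cast_ofNat]
    rw [hk]
    field_simp
    ring)
  refine ⟨k, fun a b ↦ k / 2 + φ a b, by positivity, fun a b ↦ ?_, fun b ↦ ?_⟩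
  · linarith [hφ a b]
  · rw [Finset.sum_add_distrib, hdiv]
    simp

end SimpleGraph

open Matrix in
/-- A finite connected graph has a positive eigenvector for its largest eigenvalue. -/
lemma exists_pos_eigenvector_lambdaOne {β : Type*} [Fintype β] [DecidableEq β] [Nonempty β]
    {G : SimpleGraph β} [DecidableRel G.Adj] (hG : G.Connected) :
    ∃ z : β → ℝ, (∀ b, 0 < z b) ∧
      ∀ b, ∑ c ∈ G.neighborFinset b, z c = lambdaOne G * z b := by
  set A := G.adjMatrix ℝ with hA
  have hH : A.IsHermitian := adjMatrix_isHermitian G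
  obtain ⟨i, hi⟩ : ∃ i, hH.eigenvalues i = lambdaOne G := exists_eq_ciSup_of_finite
  have hle : ∀ j, hH.eigenvalues j ≤ lambdaOne G :=
    fun j ↦ le_ciSup (f := hH.eigenvalues) (Set.finite_range _).bddAbove j
  set l := lambdaOne G with hl
  have hM : (algebraMap ℝ (Matrix β β ℝ) l - A).PosSemidef := by
    rw [posSemidef_iff_isHermitian_and_spectrum_nonneg (𝕜 := ℝ)]
    refine ⟨IsHermitian.sub ?_ hH, ?_⟩
    · rw [Matrix.algebraMap_eq_diagonal]
      exact isHermitian_diagonal _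
    · rw [← spectrum.singleton_sub_eq, hH.spectrum_real_eq_range_eigenvalues]
      rintro _ ⟨_, rfl, _, ⟨j, rfl⟩, rfl⟩
      exact sub_nonneg.mpr (hle j)
  have hmul : ∀ y : β → ℝ, (algebraMap ℝ (Matrix β β ℝ) l - A) *ᵥ y = l • y - A *ᵥ y := by
    intro y
    rw [sub_mulVec, Algebra.algebraMap_eq_smul_one, smul_mulVec, one_mulVec]
  set x : β → ℝ := ⇑(hH.eigenvectorBasis i) with hx
  have hAx : A *ᵥ x = l • x := hi ▸ hH.mulVec_eigenvectorBasis i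
  have hx0 : x ≠ 0 := by
    intro h
    refine hH.eigenvectorBasis.toBasis.ne_zero i ?_
    ext j
    simpa using congrFun h j
  set y : β → ℝ := fun b ↦ |x b| with hy
  have hAy : A *ᵥ y = l • y := by
    have h₀ : (algebraMap ℝ (Matrix β β ℝ) l - A) *ᵥ y = 0 := by
      rw [← hM.dotProduct_mulVec_zero_iff]
      refine le_antisymm ?_ (hM.dotProduct_mulVec_nonneg y)
      rw [hmul, dotProduct_sub, sub_nonpos]
      have h₁ : star y ⬝ᵥ l • y = star x ⬝ᵥ (A *ᵥ x) := by
        rw [hAx]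
        simp only [dotProduct, star_trivial, Pi.smul_apply, smul_eq_mul]
        refine Finset.sum_congr rfl fun b _ ↦ ?_
        linear_combination l * abs_mul_abs_self (x b)
      rw [h₁]
      simp only [dotProduct, mulVec, star_trivial, Finset.mul_sum]
      refine Finset.sum_le_sum fun b _ ↦ Finset.sum_le_sum fun c _ ↦ ?_
      rw [hA, adjMatrix_apply]
      split_ifs
      · simpa [hy, abs_mul] using le_abs_self (x b * x c)
      · simp
    rw [hmul] at h₀
    exact (sub_eq_zero.mp h₀).symm
  have hsum : ∀ b, ∑ c ∈ G.neighborFinset b, y c = l * y b := fun b ↦ by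
    simpa [hA, adjMatrix_mulVec_apply] using congrFun hAy b
  refine ⟨y, fun b ↦ (abs_nonneg _).lt_of_ne fun hb ↦ hx0 ?_, hsum⟩
  funext c
  have hr : Relation.ReflTransGen G.Adj b c := (reachable_iff_reflTransGen b c).mp (hG b c)
  suffices y c = 0 from abs_eq_zero.mp this
  induction hr with
  | refl => exact hb.symm
  | @tail c d _ hcd ih =>
    have := hsum c
    rw [ih, mul_zero, Finset.sum_eq_zero_iff_of_nonneg fun _ _ ↦ abs_nonneg _] at this
    exact this d (by simpa using hcd)

/-- Schur test for the quadratic form of a graph. -/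
lemma quadForm_le_of_weights {α : Type*} (T : SimpleGraph α) (w : α → α → ℝ) (ρ : ℝ)
    (hpos : ∀ u v, T.Adj u v → 0 < w u v)
    (hmul : ∀ u v, T.Adj u v → 1 ≤ w u v * w v u)
    (hsum : ∀ (u : α) (s : Finset α), (∀ v ∈ s, T.Adj u v) → ∑ v ∈ s, w u v ≤ ρ)
    (x : α →₀ ℝ) : quadForm T x ≤ ρ * ∑ v ∈ x.support, x v ^ 2 := by
  classical
  have hpt : ∀ u v, T.Adj u v → 2 * (x u * x v) ≤ w u v * x u ^ 2 + w v u * x v ^ 2 := by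
    intro u v h
    have h₁ := hpos u v h
    have h₂ := hmul u v h
    have h₃ : 0 ≤ w u v * (w u v * x u ^ 2 + w v u * x v ^ 2 - 2 * (x u * x v)) := by
      nlinarith [sq_nonneg (w u v * x u - x v), mul_nonneg (sub_nonneg.mpr h₂) (sq_nonneg (x v))]
    linarith [nonneg_of_mul_nonneg_right h₃ h₁]
  have hA : ∑ u ∈ x.support, ∑ v ∈ x.support, (if T.Adj u v then w u v * x u ^ 2 else 0) ≤
      ρ * ∑ v ∈ x.support, x v ^ 2 := by
    rw [Finset.mul_sum]
    refine Finset.sum_le_sum fun u _ ↦ ?_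
    rw [← Finset.sum_filter, ← Finset.sum_mul]
    exact mul_le_mul_of_nonneg_right (hsum u _ fun v hv ↦ (Finset.mem_filter.mp hv).2)
      (sq_nonneg _)
  have hB : ∑ u ∈ x.support, ∑ v ∈ x.support, (if T.Adj u v then w v u * x v ^ 2 else 0) =
      ∑ u ∈ x.support, ∑ v ∈ x.support, (if T.Adj u v then w u v * x u ^ 2 else 0) := by
    rw [Finset.sum_comm]
    simp_rw [T.adj_comm]
  have hC : 2 * quadForm T x ≤
      ∑ u ∈ x.support, ∑ v ∈ x.support, (if T.Adj u v then w u v * x u ^ 2 else 0) +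
      ∑ u ∈ x.support, ∑ v ∈ x.support, (if T.Adj u v then w v u * x v ^ 2 else 0) := by
    simp_rw [quadForm, Finset.mul_sum, ← Finset.sum_add_distrib]
    refine Finset.sum_le_sum fun u _ ↦ Finset.sum_le_sum fun v _ ↦ ?_
    split_ifs with h
    · exact hpt u v h
    · simp
  linarith

/-- Neighbourhood sums in a cover can be computed in the base. -/
lemma IsGraphCover.exists_neighborFinset {α β : Type*} [Fintype β] [DecidableEq β]
    {T : SimpleGraph α} {G : SimpleGraph β} [DecidableRel G.Adj] {π : T →g G}
    (hπ : IsGraphCover π) (u : α) :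
    ∃ N : Finset α, (∀ v, v ∈ N ↔ T.Adj u v) ∧
      ∀ g : β → ℝ, ∑ v ∈ N, g (π v) = ∑ c ∈ G.neighborFinset (π u), g c := by
  have hfin : (T.neighborSet u).Finite :=
    (hπ u).finite_iff_finite.mpr (Set.toFinite _)
  refine ⟨hfin.toFinset, by simp, fun g ↦ ?_⟩
  refine Finset.sum_nbij π ?_ ?_ ?_ fun _ _ ↦ rfl
  · intro v hv
    simpa using (hπ u).mapsTo (by simpa using hv)
  · simpa using (hπ u).injOn
  · simpa using (hπ u).surjOn

theorem quadForm_cover_le_lambdaOne_sub_eps_of_two_cycles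
    {α β : Type*} [Fintype β] [DecidableEq β] [Nonempty β]
    (G : SimpleGraph β) [DecidableRel G.Adj] (hG : G.Connected)
    (hcyc : ∃ s ∈ cycleSets G, ∃ t ∈ cycleSets G, s ≠ t)
    (T : SimpleGraph α) (hT : T.IsTree)
    (π : T →g G) (hπ : IsGraphCover π) :
    ∃ ε : ℝ, 0 < ε ∧ ∀ x : α →₀ ℝ,
      (∑ v ∈ x.support, (x v) ^ 2) ≤ 1 → quadForm T x ≤ lambdaOne G - ε := by
  classical
  obtain ⟨k, F, hk, hF, hFsum⟩ :=
    hG.exists_flow_of_card_lt (hG.card_lt_card_edgeFinset_of_two_cycles hcyc)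
  obtain ⟨z, hz, hzsum⟩ := exists_pos_eigenvector_lambdaOne hG
  set l := lambdaOne G with hl
  obtain ⟨r⟩ := hT.connected.nonempty
  have hl0 : 0 ≤ l := by
    refine nonneg_of_mul_nonneg_left ((hzsum (π r)).symm ▸ ?_) (hz (π r))
    exact Finset.sum_nonneg fun c _ ↦ (hz c).le
  obtain ⟨M, hM⟩ := Finite.exists_le fun p : β × β ↦ (|F p.1 p.2| + k) / (z p.1 * z p.2)
  obtain ⟨Z, hZ⟩ := Finite.exists_le z
  have hZ0 : 0 < Z := (hz (π r)).trans_le (hZ _)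
  -- The flow on `T`: weight `F` away from the root, and its negative towards the root.
  set φ : α → α → ℝ := fun u v ↦
    F (π u) (π v) - if T.dist r v < T.dist r u then k else 0 with hφ
  have hφ_anti : ∀ u v, T.Adj u v → φ v u = -φ u v := by
    intro u v huv
    have h₁ := hF (π u) (π v)
    have h₂ := hT.dist_ne_of_adj r huv
    rcases lt_or_gt_of_ne h₂ with h | h
    · simp only [hφ, h, h.not_gt, if_true, if_false]
      linarith
    · simp only [hφ, h, h.not_gt, if_true, if_false]
      linarith
  have hφ_bound : ∀ u v, |φ u v / (z (π u) * z (π v))| ≤ M := by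
    intro u v
    have hzz := mul_pos (hz (π u)) (hz (π v))
    refine le_trans ?_ (hM (π u, π v))
    rw [abs_div, abs_of_pos hzz]
    refine div_le_div_of_nonneg_right ((abs_sub _ _).trans ?_) hzz.le
    gcongr
    split_ifs
    · rw [abs_of_nonneg hk]
    · simpa using hk
  have hM0 : 0 ≤ M := (abs_nonneg _).trans (hφ_bound r r)
  set δ : ℝ := 1 / (Z ^ 2 * (l * M ^ 2 + 1)) with hδ
  have hδ0 : 0 < δ := by positivity
  set w : α → α → ℝ := fun u v ↦
    z (π v) / z (π u) * (1 + δ ^ 2 * M ^ 2 - δ * (φ u v / (z (π u) * z (π v)))) with hw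
  have hε : l * (1 + δ ^ 2 * M ^ 2) - δ / Z ^ 2 = l - δ ^ 2 := by
    have : δ * (l * M ^ 2 + 1) = 1 / Z ^ 2 := by
      rw [hδ]
      field_simp
    linear_combination δ * this
  have hsq : ∀ u v, (δ * (φ u v / (z (π u) * z (π v)))) ^ 2 ≤ δ ^ 2 * M ^ 2 := by
    intro u v
    rw [mul_pow]
    exact mul_le_mul_of_nonneg_left (sq_le_sq' (abs_le.mp (hφ_bound u v)).1
      (abs_le.mp (hφ_bound u v)).2) (sq_nonneg _)
  have hwpos : ∀ u v, 0 < w u v := by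
    intro u v
    refine mul_pos (div_pos (hz _) (hz _)) ?_
    nlinarith [hsq u v, sq_nonneg (δ * (φ u v / (z (π u) * z (π v))) - 1)]
  have hwmul : ∀ u v, T.Adj u v → 1 ≤ w u v * w v u := by
    intro u v huv
    have hu := hz (π u)
    have hv := hz (π v)
    have h₁ : w u v * w v u = (1 + δ ^ 2 * M ^ 2) ^ 2 -
        (δ * (φ u v / (z (π u) * z (π v)))) ^ 2 := by
      simp only [hw, hφ_anti u v huv]
      field_simp
      ring
    rw [h₁]
    nlinarith [hsq u v, sq_nonneg (δ ^ 2 * M ^ 2), sq_nonneg (δ * M)]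
  have hwsum : ∀ (u : α) (s : Finset α), (∀ v ∈ s, T.Adj u v) → ∑ v ∈ s, w u v ≤ l - δ ^ 2 := by
    intro u s hs
    obtain ⟨N, hN, hNsum⟩ := hπ.exists_neighborFinset u
    have hu := hz (π u)
    have hdiv : 1 ≤ ∑ v ∈ N, φ u v := by
      have h₁ : ∑ v ∈ N, (if T.dist r v < T.dist r u then k else 0) ≤ k := by
        rw [← Finset.sum_filter, Finset.sum_const, nsmul_eq_mul]
        refine mul_le_of_le_one_left hk ?_
        rw [Nat.cast_le_one, Finset.card_le_one]
        intro a ha b hb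
        rw [Finset.mem_filter, hN] at ha hb
        exact hT.eq_of_adj_of_dist_lt r ha.1 hb.1 ha.2 hb.2
      have h₂ := hNsum fun c ↦ F (π u) c
      rw [hFsum] at h₂
      rw [hφ, Finset.sum_sub_distrib, h₂]
      linarith
    calc ∑ v ∈ s, w u v ≤ ∑ v ∈ N, w u v :=
          Finset.sum_le_sum_of_subset_of_nonneg (fun v hv ↦ (hN v).mpr (hs v hv))
            fun v _ _ ↦ (hwpos u v).le
      _ = ∑ v ∈ N, (z (π v) * ((1 + δ ^ 2 * M ^ 2) / z (π u)) - φ u v * (δ / z (π u) ^ 2)) := by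
          refine Finset.sum_congr rfl fun v _ ↦ ?_
          have hv := hz (π v)
          simp only [hw]
          field_simp
      _ = l * (1 + δ ^ 2 * M ^ 2) - (∑ v ∈ N, φ u v) * (δ / z (π u) ^ 2) := by
          rw [Finset.sum_sub_distrib, ← Finset.sum_mul, ← Finset.sum_mul, hNsum z, hzsum]
          field_simp
      _ ≤ l * (1 + δ ^ 2 * M ^ 2) - δ / Z ^ 2 := by
          have h₁ : δ / Z ^ 2 ≤ δ / z (π u) ^ 2 := by
            gcongr
            exact hZ _
          have h₂ : 0 ≤ δ / z (π u) ^ 2 := by positivity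
          nlinarith
      _ = l - δ ^ 2 := hε
  refine ⟨δ ^ 2, by positivity, fun x hx ↦ ?_⟩
  have hρ : 0 ≤ l - δ ^ 2 := by simpa using hwsum r ∅ (by simp)
  exact (quadForm_le_of_weights T w _ (fun u v _ ↦ hwpos u v) hwmul hwsum x).trans
    (mul_le_of_le_one_right hρ hx)
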